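/- arXiv:1605.01373 — 2 statements merged into one kernel-verified Lean document; each statement's English description precedes it below -/
import Mathlib

section
/- For every n ≥ 1, every complex root of the polynomial f_n is a real number t satisfying 0 ≤ t < 4. -/
open Polynomial

/-- `f₀ = 0`, `f₁ = 1`, `fᵢ = f_{i−1} − f_{i−2}` for odd `i ≥ 2` and
`fᵢ = x·f_{i−1} − f_{i−2}` for even `i ≥ 2`. -/
noncomputable def fpoly : ℕ → Polynomial ℤ
  | 0 => 0
  | 1 => 1
  | (n + 2) =>
      if (n + 2) % 2 = 1 then fpoly (n + 1) - fpoly n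
      else X * fpoly (n + 1) - fpoly n

theorem fpoly_even (m : ℕ) :
    fpoly (2 * m + 2) = X * fpoly (2 * m + 1) - fpoly (2 * m) := by
  rw [fpoly, if_neg (by omega)]

theorem fpoly_odd (m : ℕ) :
    fpoly (2 * m + 3) = fpoly (2 * m + 2) - fpoly (2 * m + 1) := by
  rw [fpoly, if_pos (by omega)]

/-- Evaluated at `(a + b)²` with `a * b = 1`, the polynomials `fpoly` are rescaled Chebyshev
polynomials of the second kind. -/
theorem aeval_fpoly_mul_sub {A : Type*} [CommRing A] {a b : A} (hab : a * b = 1) (m : ℕ) :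
    aeval ((a + b) ^ 2) (fpoly (2 * m)) * (a - b) = (a + b) * (a ^ (2 * m) - b ^ (2 * m)) ∧
    aeval ((a + b) ^ 2) (fpoly (2 * m + 1)) * (a - b) = a ^ (2 * m + 1) - b ^ (2 * m + 1) := by
  induction m with
  | zero => simp [fpoly]
  | succ m ih =>
    obtain ⟨h₀, h₁⟩ := ih
    have h₂ : aeval ((a + b) ^ 2) (fpoly (2 * m + 2)) * (a - b) =
        (a + b) * (a ^ (2 * m + 2) - b ^ (2 * m + 2)) := by
      rw [fpoly_even]
      simp only [map_sub, map_mul, aeval_X]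
      linear_combination (a + b) ^ 2 * h₁ - h₀ + (a + b) * (a ^ (2 * m) - b ^ (2 * m)) * hab
    refine ⟨h₂, ?_⟩
    rw [show 2 * (m + 1) + 1 = 2 * m + 3 by ring, fpoly_odd]
    simp only [map_sub]
    linear_combination h₂ - h₁ + (a ^ (2 * m + 1) - b ^ (2 * m + 1)) * hab

theorem aeval_four_fpoly {A : Type*} [CommRing A] (m : ℕ) :
    aeval (4 : A) (fpoly (2 * m)) = 4 * m ∧ aeval (4 : A) (fpoly (2 * m + 1)) = 2 * m + 1 := by
  induction m with
  | zero => simp [fpoly]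
  | succ m ih =>
    obtain ⟨h₀, h₁⟩ := ih
    have h₂ : aeval (4 : A) (fpoly (2 * m + 2)) = 4 * (m + 1) := by
      rw [fpoly_even]
      simp only [map_sub, map_mul, aeval_X]
      linear_combination 4 * h₁ - h₀
    refine ⟨by push_cast; exact h₂, ?_⟩
    rw [show 2 * (m + 1) + 1 = 2 * m + 3 by ring, fpoly_odd]
    simp only [map_sub]
    push_cast
    linear_combination h₂ - h₁

theorem aeval_four_fpoly_ne_zero {n : ℕ} (hn : 1 ≤ n) : aeval (4 : ℂ) (fpoly n) ≠ 0 := by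
  obtain ⟨m, rfl | rfl⟩ := n.even_or_odd'
  · rw [(aeval_four_fpoly m).1]
    norm_cast
    omega
  · rw [(aeval_four_fpoly m).2]
    norm_cast

theorem exists_mul_eq_one_and_eq_add_sq (z : ℂ) : ∃ a b : ℂ, a * b = 1 ∧ z = (a + b) ^ 2 := by
  obtain ⟨w, hw⟩ := IsAlgClosed.exists_pow_nat_eq z two_pos
  obtain ⟨d, hd⟩ := IsAlgClosed.exists_pow_nat_eq (w ^ 2 - 4) two_pos
  exact ⟨(w + d) / 2, (w - d) / 2, by linear_combination -hd / 4, by rw [← hw]; ring⟩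

/-- for `n ≥ 1`, every complex root of `fₙ` is a real number `t` with
`0 ≤ t < 4`. -/
theorem statement8 (n : ℕ) (hn : 1 ≤ n) (z : ℂ)
    (hz : Polynomial.aeval z (fpoly n) = 0) :
    ∃ t : ℝ, z = (t : ℂ) ∧ 0 ≤ t ∧ t < 4 := by
  have hz4 : z ≠ 4 := by
    rintro rfl
    exact aeval_four_fpoly_ne_zero hn hz
  by_cases hz0 : z = 0
  · exact ⟨0, by simp [hz0], le_rfl, by norm_num⟩
  obtain ⟨a, b, hab, rfl⟩ := exists_mul_eq_one_and_eq_add_sq z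
  have hpow : a ^ n = b ^ n := by
    obtain ⟨m, rfl | rfl⟩ := n.even_or_odd'
    · have h := (aeval_fpoly_mul_sub hab m).1
      rw [hz, zero_mul] at h
      exact sub_eq_zero.1 ((mul_eq_zero.1 h.symm).resolve_left (by rintro h'; simp [h'] at hz0))
    · have h := (aeval_fpoly_mul_sub hab m).2
      rw [hz, zero_mul] at h
      exact sub_eq_zero.1 h.symm
  have hroot : a ^ (n + n) = 1 := by
    rw [pow_add]
    nth_rw 2 [hpow]
    rw [← mul_pow, hab, one_pow]
  have hnorm : ‖a‖ = 1 := Complex.norm_eq_one_of_pow_eq_one hroot (by omega)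
  have hb : b = (starRingEnd ℂ) a := by
    rw [← Complex.inv_eq_conj hnorm]
    exact eq_inv_of_mul_eq_one_right hab
  have hreal : (a + b) ^ 2 = (((2 * a.re) ^ 2 : ℝ) : ℂ) := by
    rw [hb, Complex.add_conj]
    push_cast
    ring
  refine ⟨(2 * a.re) ^ 2, hreal, sq_nonneg _, lt_of_le_of_ne ?_ fun h ↦ hz4 ?_⟩
  · have := (sq_le_one_iff_abs_le_one a.re).2 (hnorm ▸ Complex.abs_re_le_norm a)
    linarith
  · rw [hreal, h]
    norm_num
end

section
/- Let B be a real p×q matrix and C = Bᵀ. Define square matrices of size (p+q)×(p+q) in block form by S₁ = [[2·I_p, B],[0, 0]], T₁ = [[0, 0],[C, 2·I_q]], S₂ = S₁·T₁, T₂ = T₁·S₁, and, for i ≥ 2, S_{i+1} = S₁·T_i − S_{i−1} and T_{i+1} = T₁·S_i − T_{i−1}. Then for every odd i ≥ 1, S_i = [[2·f_i(BC), f_i(BC)·B],[0, 0]] and T_i = [[0, 0],[f_i(CB)·C, 2·f_i(CB)]], while for every even i ≥ 2, writing f_i = x·h_i with h_i ∈ ℤ[x], one has S_i = [[B·h_i(CB)·C,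 2·B·h_i(CB)],[0, 0]] and T_i = [[0, 0],[2·C·h_i(BC), C·h_i(BC)·B]]. -/
open Matrix Polynomial

theorem fpoly_odd_step (k : ℕ) : fpoly (2 * k + 3) = fpoly (2 * k + 2) - fpoly (2 * k + 1) := by
  rw [show 2 * k + 3 = (2 * k + 1) + 2 by ring, fpoly, if_pos (by omega)]

theorem fpoly_even_step (k : ℕ) :
    fpoly (2 * k + 4) = X * fpoly (2 * k + 3) - fpoly (2 * k + 2) := by
  rw [show 2 * k + 4 = (2 * k + 2) + 2 by ring, fpoly, if_neg (by omega)]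

theorem fpoly_two : fpoly 2 = X := by
  simp [fpoly]

/-- The block forms at an odd index and at the even index following it. -/
theorem block_form_odd_even {p q : ℕ} (B : Matrix (Fin p) (Fin q) ℝ)
    (C : Matrix (Fin q) (Fin p) ℝ)
    (S T : ℕ → Matrix (Fin p ⊕ Fin q) (Fin p ⊕ Fin q) ℝ)
    (hS1 : S 1 = fromBlocks (2 • (1 : Matrix (Fin p) (Fin p) ℝ)) B 0 0)
    (hT1 : T 1 = fromBlocks 0 0 C (2 • (1 : Matrix (Fin q) (Fin q) ℝ)))
    (hS2 : S 2 = S 1 * T 1) (hT2 : T 2 = T 1 * S 1)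
    (hSrec : ∀ i, 2 ≤ i → S (i + 1) = S 1 * T i - S (i - 1))
    (hTrec : ∀ i, 2 ≤ i → T (i + 1) = T 1 * S i - T (i - 1)) (k : ℕ) :
    (S (2 * k + 1) = fromBlocks (2 • aeval (B * C) (fpoly (2 * k + 1)))
        (aeval (B * C) (fpoly (2 * k + 1)) * B) 0 0 ∧
      T (2 * k + 1) = fromBlocks 0 0 (aeval (C * B) (fpoly (2 * k + 1)) * C)
        (2 • aeval (C * B) (fpoly (2 * k + 1)))) ∧
    ∃ h : Polynomial ℤ, fpoly (2 * k + 2) = X * h ∧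
      S (2 * k + 2) =
        fromBlocks (B * aeval (C * B) h * C) (2 • (B * aeval (C * B) h)) 0 0 ∧
      T (2 * k + 2) =
        fromBlocks 0 0 (2 • (C * aeval (B * C) h)) (C * aeval (B * C) h * B) := by
  induction k with
  | zero =>
    refine ⟨⟨?_, ?_⟩, 1, ?_, ?_, ?_⟩
    · simp [hS1, fpoly]
    · simp [hT1, fpoly]
    · simp [fpoly_two]
    · rw [hS2, hS1, hT1, fromBlocks_multiply, Matrix.mul_smul, Matrix.mul_one]
      simp
    · rw [hT2, hS1, hT1, fromBlocks_multiply, Matrix.mul_smul C, Matrix.mul_one]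
      simp
  | succ k ih =>
    obtain ⟨⟨hSo, hTo⟩, h, hf, hSe, hTe⟩ := ih
    have hf3 : fpoly (2 * k + 3) = X * h - fpoly (2 * k + 1) := by
      rw [fpoly_odd_step, hf]
    have hS3 : S (2 * k + 3) = fromBlocks (2 • aeval (B * C) (fpoly (2 * k + 3)))
        (aeval (B * C) (fpoly (2 * k + 3)) * B) 0 0 := by
      rw [hSrec (2 * k + 2) (by omega), show 2 * k + 2 - 1 = 2 * k + 1 by omega, hS1, hTe, hSo,
        hf3, fromBlocks_multiply, sub_eq_add_neg, fromBlocks_neg, fromBlocks_add]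
      simp [smul_add, Matrix.add_mul, Matrix.mul_assoc, sub_eq_add_neg, -nsmul_eq_mul]
    have hT3 : T (2 * k + 3) = fromBlocks 0 0 (aeval (C * B) (fpoly (2 * k + 3)) * C)
        (2 • aeval (C * B) (fpoly (2 * k + 3))) := by
      rw [hTrec (2 * k + 2) (by omega), show 2 * k + 2 - 1 = 2 * k + 1 by omega, hT1, hSe, hTo,
        hf3, fromBlocks_multiply, sub_eq_add_neg, fromBlocks_neg, fromBlocks_add]
      simp [smul_add, Matrix.add_mul, Matrix.mul_assoc, sub_eq_add_neg, -nsmul_eq_mul]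
    refine ⟨⟨hS3, hT3⟩, fpoly (2 * k + 3) - h, ?_, ?_, ?_⟩
    · rw [show 2 * (k + 1) + 2 = 2 * k + 4 by ring, fpoly_even_step, hf, mul_sub]
    · rw [show 2 * (k + 1) + 2 = 2 * k + 3 + 1 by ring, hSrec (2 * k + 3) (by omega),
        show 2 * k + 3 - 1 = 2 * k + 2 by omega, hS1, hT3, hSe,
        fromBlocks_multiply, sub_eq_add_neg, fromBlocks_neg, fromBlocks_add]
      simp [smul_add, Matrix.add_mul, Matrix.mul_add, Matrix.mul_assoc, sub_eq_add_neg, -nsmul_eq_mul]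
    · rw [show 2 * (k + 1) + 2 = 2 * k + 3 + 1 by ring, hTrec (2 * k + 3) (by omega),
        show 2 * k + 3 - 1 = 2 * k + 2 by omega, hT1, hS3, hTe,
        fromBlocks_multiply, sub_eq_add_neg, fromBlocks_neg, fromBlocks_add]
      simp [smul_add, Matrix.add_mul, Matrix.mul_add, Matrix.mul_assoc, sub_eq_add_neg, -nsmul_eq_mul]

/-- explicit block form of the matrices `Sᵢ`, `Tᵢ` defined from the
`(p+q)×(p+q)` block matrices `S₁ = [[2I,B],[0,0]]`, `T₁ = [[0,0],[C,2I]]` (`C = Bᵀ`)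
by `S₂ = S₁T₁`, `T₂ = T₁S₁`, `S_{i+1} = S₁Tᵢ − S_{i−1}`, `T_{i+1} = T₁Sᵢ − T_{i−1}`:
for odd `i`, `Sᵢ = [[2fᵢ(BC), fᵢ(BC)B],[0,0]]` and `Tᵢ = [[0,0],[fᵢ(CB)C, 2fᵢ(CB)]]`;
for even `i ≥ 2`, writing `fᵢ = x·hᵢ`, `Sᵢ = [[B hᵢ(CB) C, 2 B hᵢ(CB)],[0,0]]` and
`Tᵢ = [[0,0],[2 C hᵢ(BC), C hᵢ(BC) B]]`. -/
theorem statement9 {p q : ℕ} (B : Matrix (Fin p) (Fin q) ℝ)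
    (C : Matrix (Fin q) (Fin p) ℝ) (hC : C = Bᵀ)
    (S T : ℕ → Matrix (Fin p ⊕ Fin q) (Fin p ⊕ Fin q) ℝ)
    (hS1 : S 1 = fromBlocks (2 • (1 : Matrix (Fin p) (Fin p) ℝ)) B 0 0)
    (hT1 : T 1 = fromBlocks 0 0 C (2 • (1 : Matrix (Fin q) (Fin q) ℝ)))
    (hS2 : S 2 = S 1 * T 1) (hT2 : T 2 = T 1 * S 1)
    (hSrec : ∀ i, 2 ≤ i → S (i + 1) = S 1 * T i - S (i - 1))
    (hTrec : ∀ i, 2 ≤ i → T (i + 1) = T 1 * S i - T (i - 1)) :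
    ∀ i : ℕ,
      (i % 2 = 1 →
        S i = fromBlocks (2 • aeval (B * C) (fpoly i))
                (aeval (B * C) (fpoly i) * B) 0 0 ∧
        T i = fromBlocks 0 0 (aeval (C * B) (fpoly i) * C)
                (2 • aeval (C * B) (fpoly i))) ∧
      (i % 2 = 0 → 2 ≤ i → ∀ h : Polynomial ℤ, fpoly i = X * h →
        S i = fromBlocks (B * aeval (C * B) h * C) (2 • (B * aeval (C * B) h)) 0 0 ∧
        T i = fromBlocks 0 0 (2 • (C * aeval (B * C) h)) (C * aeval (B * C) h * B)) := by
  intro i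
  have key := block_form_odd_even B C S T hS1 hT1 hS2 hT2 hSrec hTrec
  refine ⟨fun hi => ?_, fun hi hi2 h hf => ?_⟩
  · obtain ⟨k, rfl⟩ : ∃ k, i = 2 * k + 1 := ⟨i / 2, by omega⟩
    exact (key k).1
  · obtain ⟨k, rfl⟩ : ∃ k, i = 2 * k + 2 := ⟨i / 2 - 1, by omega⟩
    obtain ⟨-, g, hg, hST⟩ := key k
    obtain rfl : g = h := mul_left_cancel₀ X_ne_zero (hg.symm.trans hf)
    exact hST
end
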